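/- Let g > 0, m > 0, z_s > 0, θ ∈ (−π/2, π/2), and let ω > 0 satisfy ω² > ω_ac²(z_s). Define ξ = ω²/(ω² − ω_ac²(z_s)) (so ξ > 1), k_s = √((ω² − ω_ac²(z_s))/c²(z_s)), k_h = k_s·cos θ, a = ω²m/(2k_h²g), and b² = a² − m(m+2)/(4k_h²). Then a = ξ·z_s/(2cos²θ) and b² = (z_s²/(4cos⁴θ))·((ξ−2)² + 4(ξ−1)·sin²θ). In particular b² ≥ 0 always, and b² = 0 if and only if ξ = 2 and θ = 0. -/

import Mathlib

/-- For a monochromatic point source of frequency `ω` at depth `z_s` in the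
polytrope model, with `ξ = ω²/(ω² - ω_ac²(z_s))`, `k_s = √((ω² - ω_ac²(z_s))/c²(z_s))`,
`k_h = k_s cos θ`, `a = ω²m/(2k_h²g)` and `b² = a² - m(m+2)/(4k_h²)`:
`ξ > 1`, `a = ξ z_s/(2cos²θ)`,
`b² = (z_s²/(4cos⁴θ))((ξ-2)² + 4(ξ-1)sin²θ)`; in particular `b² ≥ 0`, with
`b² = 0` if and only if `ξ = 2` and `θ = 0`. -/
theorem point_source_a_b_formulas
    (g m zs θ ω : ℝ) (hg : 0 < g) (hm : 0 < m) (hzs : 0 < zs)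
    (hθ : θ ∈ Set.Ioo (-(Real.pi / 2)) (Real.pi / 2))
    (hω : 0 < ω)
    (hcut : g * (m + 2) / (4 * zs) < ω ^ 2)
    (ξ ks kh a b2 : ℝ)
    (hξ : ξ = ω ^ 2 / (ω ^ 2 - g * (m + 2) / (4 * zs)))
    (hks : ks = Real.sqrt ((ω ^ 2 - g * (m + 2) / (4 * zs)) / (g * zs / m)))
    (hkh : kh = ks * Real.cos θ)
    (ha : a = ω ^ 2 * m / (2 * kh ^ 2 * g))
    (hb2 : b2 = a ^ 2 - m * (m + 2) / (4 * kh ^ 2)) :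
    1 < ξ ∧
    a = ξ * zs / (2 * Real.cos θ ^ 2) ∧
    b2 = zs ^ 2 / (4 * Real.cos θ ^ 4) *
      ((ξ - 2) ^ 2 + 4 * (ξ - 1) * Real.sin θ ^ 2) ∧
    0 ≤ b2 ∧
    (b2 = 0 ↔ ξ = 2 ∧ θ = 0) := by
  have hC : 0 < Real.cos θ := Real.cos_pos_of_mem_Ioo hθ
  have hSC : Real.sin θ ^ 2 = 1 - Real.cos θ ^ 2 := Real.sin_sq θ
  obtain ⟨W, hW⟩ : ∃ W, W = g * (m + 2) / (4 * zs) := ⟨_, rfl⟩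
  have hWpos : 0 < W := by rw [hW]; positivity
  have hWm : (m + 2) * g = 4 * zs * W := by rw [hW]; field_simp
  rw [← hW] at hcut hξ hks
  obtain ⟨D, hD⟩ : ∃ D, D = ω ^ 2 - W := ⟨_, rfl⟩
  have hDpos : 0 < D := by linarith
  rw [← hD] at hξ hks
  have hks2 : ks ^ 2 = D / (g * zs / m) := by
    rw [hks]; exact Real.sq_sqrt (by positivity)
  have hkh2 : kh ^ 2 = D * m * Real.cos θ ^ 2 / (g * zs) := by
    rw [hkh, mul_pow, hks2]; field_simp
  have hξ1 : ξ - 1 = W / D := by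
    rw [hξ]; field_simp; linarith
  have h1 : 1 < ξ := by
    have : 0 < W / D := by positivity
    linarith
  have hA : a = ξ * zs / (2 * Real.cos θ ^ 2) := by
    rw [ha, hkh2, hξ]; field_simp
  have hT : m * (m + 2) / (4 * kh ^ 2) = (ξ - 1) * zs ^ 2 / Real.cos θ ^ 2 := by
    rw [hkh2, hξ1]; field_simp; linarith
  have hB : b2 = zs ^ 2 / (4 * Real.cos θ ^ 4) *
      ((ξ - 2) ^ 2 + 4 * (ξ - 1) * Real.sin θ ^ 2) := by
    rw [hb2, hT, hA, hSC]; field_simp; ring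
  have hp : 0 < zs ^ 2 / (4 * Real.cos θ ^ 4) := by positivity
  have hξp : 0 < ξ - 1 := by linarith
  have hs : 0 ≤ 4 * (ξ - 1) * Real.sin θ ^ 2 := by positivity
  refine ⟨h1, hA, hB, ?_, ?_, ?_⟩
  · rw [hB]; positivity
  · intro h
    rw [hB] at h
    have h2 := (mul_eq_zero.mp h).resolve_left hp.ne'
    have h3 : (ξ - 2) ^ 2 = 0 := by nlinarith [sq_nonneg (ξ - 2)]
    have h4 : 4 * (ξ - 1) * Real.sin θ ^ 2 = 0 := by linarith
    have h5 : Real.sin θ = 0 := by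
      have := (mul_eq_zero.mp h4).resolve_left (by positivity)
      exact pow_eq_zero_iff (two_ne_zero) |>.mp this
    have h6 : ξ - 2 = 0 := pow_eq_zero_iff (two_ne_zero) |>.mp h3
    refine ⟨by linarith, ?_⟩
    have hpi := Real.pi_pos
    exact (Real.sin_eq_zero_iff_of_lt_of_lt (by linarith [hθ.1]) (by linarith [hθ.2])).mp h5
  · rintro ⟨h2, h3⟩
    rw [hB, h2, h3]; simp
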